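/- arXiv:0707.1626 — 5 statements merged into one kernel-verified Lean document; each statement's English description precedes it below -/
import Mathlib

section
/- Let (X,d,W) be a complete uniformly convex hyperbolic space having a monotone modulus of uniform convexity η. Then every nonempty closed convex bounded subset C of X has the fixed point property for asymptotically nonexpansive mappings; that is, every asymptotically nonexpansive mapping T : C → C has a fixed point. -/
open Filter Set

section Hyperbolic

variable {X : Type*}

/-- A hyperbolic space structure: `W x y t` represents `(1-t)x ⊕ t y`. -/
structure IsWMap [MetricSpace X] (W : X → X → ℝ → X) : Prop where
  w1 : ∀ (x y z : X), ∀ t ∈ Set.Icc (0:ℝ) 1,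
    dist z (W x y t) ≤ (1 - t) * dist z x + t * dist z y
  w2 : ∀ (x y : X), ∀ t ∈ Set.Icc (0:ℝ) 1, ∀ s ∈ Set.Icc (0:ℝ) 1,
    dist (W x y t) (W x y s) = |t - s| * dist x y
  w3 : ∀ (x y : X), ∀ t ∈ Set.Icc (0:ℝ) 1, W x y t = W y x (1 - t)
  w4 : ∀ (x y z w : X), ∀ t ∈ Set.Icc (0:ℝ) 1,
    dist (W x z t) (W y w t) ≤ (1 - t) * dist x y + t * dist z w

/-- `η` is a modulus of uniform convexity for the hyperbolic space `(X, dist, W)`. -/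
def IsUCModulus [MetricSpace X] (W : X → X → ℝ → X) (η : ℝ → ℝ → ℝ) : Prop :=
  (∀ r ε : ℝ, 0 < r → ε ∈ Set.Ioc (0:ℝ) 2 → η r ε ∈ Set.Ioc (0:ℝ) 1) ∧
  (∀ r ε : ℝ, ∀ a x y : X, 0 < r → ε ∈ Set.Ioc (0:ℝ) 2 →
    dist x a ≤ r → dist y a ≤ r → ε * r ≤ dist x y →
    dist (W x y (1/2)) a ≤ (1 - η r ε) * r)

/-- The modulus `η` is monotone: nonincreasing in `r` for each fixed `ε`. -/
def MonotoneUCModulus (η : ℝ → ℝ → ℝ) : Prop :=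
  ∀ ε ∈ Set.Ioc (0:ℝ) 2, ∀ r s : ℝ, 0 < r → r ≤ s → η s ε ≤ η r ε

/-- `C` is a convex subset w.r.t. the convexity map `W`. -/
def WConvex [MetricSpace X] (W : X → X → ℝ → X) (C : Set X) : Prop :=
  ∀ x ∈ C, ∀ y ∈ C, ∀ t ∈ Set.Icc (0:ℝ) 1, W x y t ∈ C

/-- `T : C → C` is asymptotically nonexpansive with sequence `k`. -/
def AsymptoticallyNonexpansive [MetricSpace X] (C : Set X) (T : X → X) (k : ℕ → ℝ) : Prop :=
  Set.MapsTo T C C ∧ (∀ n, 0 ≤ k n) ∧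
  Filter.Tendsto k Filter.atTop (nhds 0) ∧
  ∀ n : ℕ, ∀ x ∈ C, ∀ y ∈ C, dist (T^[n] x) (T^[n] y) ≤ (1 + k n) * dist x y

/-- `xseq` is the Krasnoselski–Mann iteration of `T` starting from `x`:
`x₀ = x`, `x_{n+1} = (1-λ_n) x_n ⊕ λ_n T^n x_n`. -/
def IsKMIteration [MetricSpace X] (W : X → X → ℝ → X) (T : X → X) (lam : ℕ → ℝ)
    (x : X) (xseq : ℕ → X) : Prop :=
  xseq 0 = x ∧ ∀ n, xseq (n + 1) = W (xseq n) (T^[n] (xseq n)) (lam n)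

end Hyperbolic

/-- The points of `C` whose distance to the sequence `u` is eventually at most `s`. -/
def asymptoticBall {X : Type*} [MetricSpace X] (C : Set X) (u : ℕ → X) (s : ℝ) : Set X :=
  {y | y ∈ C ∧ ∀ᶠ n in atTop, dist y (u n) ≤ s}

/-- The asymptotic radius of the sequence `u` with respect to `C`. -/
noncomputable def asymptoticRadius {X : Type*} [MetricSpace X] (C : Set X) (u : ℕ → X) : ℝ :=
  sInf {s | (asymptoticBall C u s).Nonempty}

section AsymptoticCenter

variable {X : Type*} [MetricSpace X] {C : Set X} {u : ℕ → X}

theorem asymptoticBall_mono {s t : ℝ} (hst : s ≤ t) :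
    asymptoticBall C u s ⊆ asymptoticBall C u t :=
  fun _ hy => ⟨hy.1, hy.2.mono fun _ h => h.trans hst⟩

theorem nonneg_of_mem_asymptoticBall {s : ℝ} {y : X} (hy : y ∈ asymptoticBall C u s) : 0 ≤ s := by
  obtain ⟨n, hn⟩ := hy.2.exists
  exact dist_nonneg.trans hn

theorem dist_le_of_mem_asymptoticBall {s : ℝ} {y z : X} (hy : y ∈ asymptoticBall C u s)
    (hz : z ∈ asymptoticBall C u s) : dist y z ≤ 2 * s := by
  obtain ⟨n, hyn, hzn⟩ := (hy.2.and hz.2).exists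
  linarith [dist_triangle_right y z (u n)]

theorem asymptoticRadius_le {s : ℝ} {y : X} (hy : y ∈ asymptoticBall C u s) :
    asymptoticRadius C u ≤ s :=
  csInf_le ⟨0, fun _ ⟨_, hz⟩ => nonneg_of_mem_asymptoticBall hz⟩ ⟨y, hy⟩

theorem asymptoticRadius_nonneg : 0 ≤ asymptoticRadius C u :=
  Real.sInf_nonneg fun _ ⟨_, hz⟩ => nonneg_of_mem_asymptoticBall hz

theorem exists_mem_asymptoticBall (hbd : Bornology.IsBounded C) (hne : C.Nonempty)
    (hu : ∀ n, u n ∈ C) {s : ℝ} (hs : asymptoticRadius C u < s) :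
    (asymptoticBall C u s).Nonempty := by
  have hS : {s | (asymptoticBall C u s).Nonempty}.Nonempty := by
    obtain ⟨x, hx⟩ := hne
    exact ⟨Metric.diam C, x, hx,
      Eventually.of_forall fun n => Metric.dist_le_diam_of_mem hbd hx (hu n)⟩
  obtain ⟨t, ⟨y, hy⟩, hts⟩ := exists_lt_of_csInf_lt hS hs
  exact ⟨y, asymptoticBall_mono hts.le hy⟩

/-- Uniform convexity forces the asymptotic balls to shrink as their radius decreases to the
asymptotic radius. -/
theorem exists_asymptoticBall_dist_le {W : X → X → ℝ → X} {η : ℝ → ℝ → ℝ}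
    (hUC : IsUCModulus W η) (hMon : MonotoneUCModulus η) (hconv : WConvex W C)
    {ε : ℝ} (hε : 0 < ε) :
    ∃ δ > 0, ∀ y ∈ asymptoticBall C u (asymptoticRadius C u + δ),
      ∀ z ∈ asymptoticBall C u (asymptoticRadius C u + δ), dist y z ≤ ε := by
  set ρ := asymptoticRadius C u with hρ
  have hρ0 : 0 ≤ ρ := asymptoticRadius_nonneg
  have hB : 0 < ρ + 1 := by linarith
  set e := min (ε / (ρ + 1)) 2
  have he' : e ∈ Set.Ioc (0 : ℝ) 2 := ⟨lt_min (by positivity) two_pos, min_le_right _ _⟩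
  have heB : e * (ρ + 1) ≤ ε := (le_div_iff₀ hB).1 (min_le_left _ _)
  have hη := (hUC.1 (ρ + 1) e hB he').1
  set δ := min 1 (η (ρ + 1) e * ε / 4)
  have hδ0 : 0 < δ := lt_min one_pos (by positivity)
  have hδ1 : δ ≤ 1 := min_le_left _ _
  have hδ2 : δ ≤ η (ρ + 1) e * ε / 4 := min_le_right _ _
  refine ⟨δ, hδ0, fun y hy z hz => ?_⟩
  by_contra! hlt
  have hs : 0 < ρ + δ := by linarith
  have hsB : ρ + δ ≤ ρ + 1 := by linarith
  have hε2 : ε < 2 * (ρ + δ) := hlt.trans_le (dist_le_of_mem_asymptoticBall hy hz)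
  have hsep : e * (ρ + δ) ≤ dist y z :=
    ((mul_le_mul_of_nonneg_left hsB he'.1.le).trans heB).trans hlt.le
  have hmid : W y z (1 / 2) ∈ asymptoticBall C u ((1 - η (ρ + δ) e) * (ρ + δ)) := by
    refine ⟨hconv y hy.1 z hz.1 _ ⟨by norm_num, by norm_num⟩, ?_⟩
    filter_upwards [hy.2, hz.2] with n hyn hzn
    exact hUC.2 _ _ _ _ _ hs he' hyn hzn hsep
  have hle := asymptoticRadius_le hmid
  have hmono := hMon e he' _ _ hs hsB
  have h₁ := mul_le_mul_of_nonneg_right hmono hs.le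
  have h₂ := mul_lt_mul_of_pos_left hε2 hη
  have h₃ : 0 < η (ρ + 1) e * ε := by positivity
  rw [← hρ] at hle
  linarith

/-- A bounded sequence in `C` has an asymptotic center. -/
theorem exists_asymptoticCenter [CompleteSpace X] {W : X → X → ℝ → X} {η : ℝ → ℝ → ℝ}
    (hUC : IsUCModulus W η) (hMon : MonotoneUCModulus η) (hconv : WConvex W C)
    (hne : C.Nonempty) (hcl : IsClosed C) (hbd : Bornology.IsBounded C) (hu : ∀ n, u n ∈ C) :
    ∃ p, ∀ s, asymptoticRadius C u < s → p ∈ asymptoticBall C u s := by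
  set ρ := asymptoticRadius C u
  have hex (n : ℕ) : (asymptoticBall C u (ρ + 1 / (n + 1))).Nonempty :=
    exists_mem_asymptoticBall hbd hne hu (lt_add_of_pos_right _ Nat.one_div_pos_of_nat)
  choose y hy using hex
  have hmem {δ : ℝ} (hδ : 0 < δ) : ∀ᶠ n in atTop, y n ∈ asymptoticBall C u (ρ + δ) := by
    filter_upwards [tendsto_one_div_add_atTop_nhds_zero_nat.eventually_lt_const hδ] with n hn
    exact asymptoticBall_mono (by linarith) (hy n)
  have hcauchy : CauchySeq y := by
    refine Metric.cauchySeq_iff.2 fun ε hε => ?_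
    obtain ⟨δ, hδ, hdist⟩ :=
      exists_asymptoticBall_dist_le (u := u) hUC hMon hconv (half_pos hε)
    obtain ⟨N, hN⟩ := eventually_atTop.1 (hmem hδ)
    exact ⟨N, fun m hm n hn => (hdist _ (hN m hm) _ (hN n hn)).trans_lt (half_lt_self hε)⟩
  obtain ⟨p, hp⟩ := cauchySeq_tendsto_of_complete hcauchy
  refine ⟨p, fun s hs => ⟨hcl.mem_of_tendsto hp (Eventually.of_forall fun n => (hy n).1), ?_⟩⟩
  have hδ : 0 < (s - ρ) / 2 := by linarith
  obtain ⟨n, hn, hnp⟩ := ((hmem hδ).and (Metric.tendsto_nhds.1 hp _ hδ)).exists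
  filter_upwards [hn.2] with m hm
  linarith [dist_triangle p (y n) (u m), dist_comm p (y n)]

end AsymptoticCenter

theorem AsymptoticallyNonexpansive.iterate_mem_asymptoticBall {X : Type*} [MetricSpace X]
    {C : Set X} {T : X → X} {k : ℕ → ℝ} (hT : AsymptoticallyNonexpansive C T k) {x p : X}
    (hx : x ∈ C) {s : ℝ} (hp : p ∈ asymptoticBall C (fun n => T^[n] x) s) (m : ℕ) :
    T^[m] p ∈ asymptoticBall C (fun n => T^[n] x) ((1 + k m) * s) := by
  obtain ⟨hmaps, hk, -, hlip⟩ := hT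
  refine ⟨hmaps.iterate m hp.1, ?_⟩
  obtain ⟨N, hN⟩ := eventually_atTop.1 hp.2
  filter_upwards [eventually_ge_atTop (N + m)] with n hn
  obtain ⟨j, rfl⟩ := Nat.exists_eq_add_of_le' (le_of_add_le_right hn)
  rw [add_comm j m, Function.iterate_add_apply]
  exact (hlip m p hp.1 _ (hmaps.iterate j hx)).trans
    (mul_le_mul_of_nonneg_left (hN j (by omega)) (by linarith [hk m]))

/-- Complete uniformly convex hyperbolic spaces with a monotone modulus:
nonempty closed convex bounded subsets have the FPP for asymptotically nonexpansive mappings. -/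
theorem fpp_asymptotically_nonexpansive_uchyp
    {X : Type*} [MetricSpace X] [CompleteSpace X]
    (W : X → X → ℝ → X) (η : ℝ → ℝ → ℝ)
    (hW : IsWMap W) (hUC : IsUCModulus W η) (hMon : MonotoneUCModulus η)
    (C : Set X) (hne : C.Nonempty) (hcl : IsClosed C) (hconv : WConvex W C)
    (hbd : Bornology.IsBounded C)
    (T : X → X) (k : ℕ → ℝ) (hT : AsymptoticallyNonexpansive C T k) :
    ∃ p ∈ C, T p = p := by
  obtain ⟨x, hx⟩ := hne
  have hmaps := hT.1
  set u : ℕ → X := fun n => T^[n] x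
  obtain ⟨p, hp⟩ := exists_asymptoticCenter (u := u) hUC hMon hconv ⟨x, hx⟩ hcl hbd
    fun n => hmaps.iterate n hx
  have hpC : p ∈ C := (hp _ (lt_add_one _)).1
  have hlim : Tendsto (fun m => T^[m] p) atTop (nhds p) := by
    refine Metric.tendsto_nhds.2 fun ε hε => ?_
    obtain ⟨δ, hδ, hdist⟩ :=
      exists_asymptoticBall_dist_le (u := u) hUC hMon hconv (half_pos hε)
    have hk : Tendsto (fun m => (1 + k m) * (asymptoticRadius C u + δ / 2)) atTop
        (nhds ((1 + 0) * (asymptoticRadius C u + δ / 2))) :=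
      (hT.2.2.1.const_add 1).mul_const _
    filter_upwards [hk.eventually_lt_const
      (show _ < asymptoticRadius C u + δ by linarith)] with m hm
    refine (hdist _ (asymptoticBall_mono hm.le ?_) _ (hp _ (by linarith))).trans_lt
      (half_lt_self hε)
    exact hT.iterate_mem_asymptoticBall hx (hp _ (by linarith)) m
  have hlimT : Tendsto (fun m => T^[m + 1] p) atTop (nhds (T p)) := by
    refine tendsto_iff_dist_tendsto_zero.2 (squeeze_zero (fun _ => dist_nonneg) (fun m => ?_)
      (by simpa using (tendsto_iff_dist_tendsto_zero.1 hlim).const_mul (1 + k 1)))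
    rw [Function.iterate_succ_apply']
    exact hT.2.2.2 1 _ (hmaps.iterate m hpC) p hpC
  exact ⟨p, hpC, tendsto_nhds_unique hlimT (hlim.comp (tendsto_add_atTop_nat 1))⟩
end

section
/- Let (X,d,W) be a complete uniformly convex hyperbolic space with a monotone modulus of uniform convexity η. Then the intersection of any decreasing sequence (C_n)_{n≥1} of nonempty bounded closed convex subsets of X is nonempty. -/
open Filter Set

/-- Cantor's intersection theorem for an antitone sequence of sets whose points become
uniformly close. -/
theorem iInter_nonempty_of_antitone_of_dist_le {X : Type*} [MetricSpace X] [CompleteSpace X]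
    {A : ℕ → Set X} (hA : Antitone A) (hne : ∀ n, (A n).Nonempty) (hcl : ∀ n, IsClosed (A n))
    (hsmall : ∀ ε > 0, ∃ n, ∀ x ∈ A n, ∀ y ∈ A n, dist x y ≤ ε) :
    (⋂ n, A n).Nonempty := by
  choose x hx using hne
  have hmem : ∀ n m, n ≤ m → x m ∈ A n := fun n m h => hA h (hx m)
  have hcauchy : CauchySeq x := by
    refine Metric.cauchySeq_iff'.2 fun ε hε => ?_
    obtain ⟨N, hN⟩ := hsmall (ε / 2) (half_pos hε)
    exact ⟨N, fun n hn => (hN _ (hmem N n hn) _ (hx N)).trans_lt (half_lt_self hε)⟩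
  obtain ⟨l, hl⟩ := cauchySeq_tendsto_of_complete hcauchy
  refine ⟨l, mem_iInter.2 fun n => (hcl n).mem_of_tendsto hl ?_⟩
  filter_upwards [eventually_ge_atTop n] with m hm using hmem n m hm

/-- In a convex set, points of a ball of radius `r` are close to each other as soon as uniform
convexity would push their midpoint closer to the centre than the set is. -/
theorem dist_le_of_mem_closedBall_of_lt_infDist {X : Type*} [MetricSpace X]
    {W : X → X → ℝ → X} {η : ℝ → ℝ → ℝ} (hUC : IsUCModulus W η) (hMon : MonotoneUCModulus η)
    {C : Set X} (hC : WConvex W C) {a x y : X} {r R e : ℝ} (hr : 0 < r) (hrR : r ≤ R)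
    (he : e ∈ Set.Ioc (0 : ℝ) 2) (hlt : (1 - η R e) * r < Metric.infDist a C)
    (hx : x ∈ C) (hy : y ∈ C) (hxa : dist x a ≤ r) (hya : dist y a ≤ r) :
    dist x y ≤ e * r := by
  by_contra! h
  have hmid : W x y (1 / 2) ∈ C := hC x hx y hy _ (by norm_num)
  have hball := hUC.2 r e a x y hr he hxa hya h.le
  have hinf := Metric.infDist_le_dist_of_mem (x := a) hmid
  rw [dist_comm] at hinf
  have hη := mul_le_mul_of_nonneg_right (hMon e he r R hr hrR) hr.le
  linarith

/-- In a complete uniformly convex hyperbolic space with a monotone modulus,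
the intersection of a decreasing sequence of nonempty bounded closed convex sets is nonempty. -/
theorem iInter_nonempty_of_decreasing_closed_convex_bounded
    {X : Type*} [MetricSpace X] [CompleteSpace X]
    (W : X → X → ℝ → X) (η : ℝ → ℝ → ℝ)
    (hW : IsWMap W) (hUC : IsUCModulus W η) (hMon : MonotoneUCModulus η)
    (C : ℕ → Set X)
    (hne : ∀ n, (C n).Nonempty) (hbd : ∀ n, Bornology.IsBounded (C n))
    (hcl : ∀ n, IsClosed (C n)) (hconv : ∀ n, WConvex W (C n))
    (hdec : ∀ n, C (n + 1) ⊆ C n) :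
    (⋂ n, C n).Nonempty := by
  have hanti : Antitone C := antitone_nat_of_succ_le hdec
  obtain ⟨a, ha⟩ := hne 0
  have hmono : Monotone fun n => Metric.infDist a (C n) := fun m n hmn =>
    Metric.infDist_le_infDist_of_subset (hanti hmn) (hne n)
  have hbdd : BddAbove (range fun n => Metric.infDist a (C n)) := by
    refine ⟨Metric.diam (C 0), ?_⟩
    rintro _ ⟨n, rfl⟩
    obtain ⟨y, hy⟩ := hne n
    exact (Metric.infDist_le_dist_of_mem hy).trans
      (Metric.dist_le_diam_of_mem (hbd 0) ha (hanti n.zero_le hy))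
  set d := ⨆ n, Metric.infDist a (C n)
  have hlim : Tendsto (fun n => Metric.infDist a (C n)) atTop (nhds d) :=
    tendsto_atTop_ciSup hmono hbdd
  have hle : ∀ n, Metric.infDist a (C n) ≤ d := le_ciSup hbdd
  have hd : 0 ≤ d := Metric.infDist_nonneg.trans (hle 0)
  have hr : Tendsto (fun n : ℕ => d + 1 / ((n : ℝ) + 1)) atTop (nhds d) := by
    simpa using tendsto_one_div_add_atTop_nhds_zero_nat.const_add d
  have hrpos : ∀ n : ℕ, 0 < d + 1 / ((n : ℝ) + 1) := fun n => by positivity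
  have hrR : ∀ n : ℕ, d + 1 / ((n : ℝ) + 1) ≤ d + 1 := fun n => by
    have : 1 / ((n : ℝ) + 1) ≤ 1 := div_le_one_of_le₀ (by simp) (by positivity)
    linarith
  suffices h : (⋂ n : ℕ, C n ∩ Metric.closedBall a (d + 1 / ((n : ℝ) + 1))).Nonempty from
    h.mono (iInter_mono fun n => inter_subset_left)
  refine iInter_nonempty_of_antitone_of_dist_le ?_ ?_
    (fun n => (hcl n).inter Metric.isClosed_closedBall) ?_
  · intro m n hmn
    exact inter_subset_inter (hanti hmn) (Metric.closedBall_subset_closedBall (by gcongr))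
  · intro n
    have hlt : Metric.infDist a (C n) < d + 1 / ((n : ℝ) + 1) :=
      (hle n).trans_lt (lt_add_of_pos_right _ (by positivity))
    obtain ⟨y, hy, hya⟩ := (Metric.infDist_lt_iff (hne n)).1 hlt
    exact ⟨y, hy, Metric.mem_closedBall'.2 hya.le⟩
  · intro ε hε
    rcases hd.eq_or_lt with hd0 | hdpos
    · have hev := hr.eventually (gt_mem_nhds (show d < ε / 2 by linarith))
      obtain ⟨n, hn⟩ := hev.exists
      refine ⟨n, fun x hx y hy => ?_⟩
      have hxa := Metric.mem_closedBall.1 hx.2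
      have hya := Metric.mem_closedBall.1 hy.2
      linarith [dist_triangle_right x y a]
    · set e := min (ε / (d + 1)) 2
      have he : e ∈ Set.Ioc (0 : ℝ) 2 := ⟨lt_min (by positivity) two_pos, min_le_right _ _⟩
      have hη := (hUC.1 (d + 1) e (by positivity) he).1
      have hev := (hr.const_mul (1 - η (d + 1) e)).eventually_lt hlim (by nlinarith)
      obtain ⟨n, hn⟩ := hev.exists
      refine ⟨n, fun x hx y hy => ?_⟩
      calc dist x y ≤ e * (d + 1 / ((n : ℝ) + 1)) :=
            dist_le_of_mem_closedBall_of_lt_infDist hUC hMon (hconv n) (hrpos n) (hrR n) he hn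
              hx.1 hy.1 hx.2 hy.2
        _ ≤ ε / (d + 1) * (d + 1) :=
            mul_le_mul (min_le_left _ _) (hrR n) (hrpos n).le (by positivity)
        _ = ε := div_mul_cancel₀ _ (by positivity)
end

section
/- Let (X,d,W) be a uniformly convex hyperbolic space having a monotone modulus of uniform convexity η (no completeness assumed). Then every nonempty convex bounded subset C of X has the approximate fixed point property for asymptotically nonexpansive mappings: for every asymptotically nonexpansive T : C → C and every ε > 0 there exists p ∈ C with d(p, Tp) < ε. -/
open Filter Set

/-- Two points that are both nearly optimal asymptotic centers of a sequence are close. -/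
theorem dist_lt_of_nearly_optimal_centers {X : Type*} [MetricSpace X]
    {W : X → X → ℝ → X} {η : ℝ → ℝ → ℝ}
    (hUC : IsUCModulus W η) (hMon : MonotoneUCModulus η)
    {C : Set X} (hconv : WConvex W C) (u : ℕ → X) {ρ : ℝ} (hρ : 0 < ρ)
    (hmin : ∀ b, ∀ x ∈ C, (∀ᶠ i in atTop, dist (u i) x ≤ b) → ρ ≤ b)
    {ε : ℝ} (hε : 0 < ε) :
    ∃ δ > 0, ∀ x ∈ C, ∀ z ∈ C, (∀ᶠ i in atTop, dist (u i) x ≤ ρ + δ) →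
      (∀ᶠ i in atTop, dist (u i) z ≤ ρ + δ) → dist x z < ε := by
  set t : ℝ := min 2 (ε / (ρ + 1))
  have htm : t ∈ Set.Ioc (0:ℝ) 2 := ⟨by positivity, min_le_left _ _⟩
  obtain ⟨hη0, -⟩ := hUC.1 (ρ + 1) t (by linarith) htm
  set h := η (ρ + 1) t
  refine ⟨min 1 (h * ρ / 2), by positivity, fun x hx z hz hux huz => ?_⟩
  set δ := min 1 (h * ρ / 2)
  have hδ1 : δ ≤ 1 := min_le_left _ _
  have hδ2 : δ ≤ h * ρ / 2 := min_le_right _ _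
  have hδ0 : 0 < δ := by positivity
  by_contra! hxz
  have htε : t * (ρ + δ) ≤ dist x z := by
    calc t * (ρ + δ) ≤ ε / (ρ + 1) * (ρ + 1) := by
          gcongr
          exact min_le_right _ _
      _ = ε := by field_simp
      _ ≤ dist x z := hxz
  have hmono : h ≤ η (ρ + δ) t := hMon t htm _ _ (by linarith) (by linarith)
  have hle := hmin ((1 - h) * (ρ + δ)) _ (hconv x hx z hz (1 / 2) (by norm_num)) (by
    filter_upwards [hux, huz] with i hi hi'
    rw [dist_comm] at hi hi' ⊢
    calc _ ≤ (1 - η (ρ + δ) t) * (ρ + δ) :=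
          hUC.2 (ρ + δ) t (u i) x z (by linarith) htm hi hi' htε
      _ ≤ _ := by gcongr)
  nlinarith [mul_pos hη0 hρ, mul_pos hη0 hδ0]


/-- In a (not necessarily complete) uniformly convex hyperbolic space with a
monotone modulus, nonempty convex bounded subsets have the AFPP for asymptotically
nonexpansive mappings. -/
theorem afpp_asymptotically_nonexpansive_uchyp
    {X : Type*} [MetricSpace X]
    (W : X → X → ℝ → X) (η : ℝ → ℝ → ℝ)
    (hW : IsWMap W) (hUC : IsUCModulus W η) (hMon : MonotoneUCModulus η)
    (C : Set X) (hne : C.Nonempty) (hconv : WConvex W C)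
    (hbd : Bornology.IsBounded C)
    (T : X → X) (k : ℕ → ℝ) (hT : AsymptoticallyNonexpansive C T k) :
    ∀ ε > (0:ℝ), ∃ p ∈ C, dist p (T p) < ε := by
  intro ε hε
  obtain ⟨hmaps, hk0, hklim, hlip⟩ := hT
  obtain ⟨y, hy⟩ := hne
  have horb : ∀ x ∈ C, ∀ i, T^[i] x ∈ C := fun x hx i => hmaps.iterate i hx
  set B : Set ℝ := {b | ∃ x ∈ C, ∀ᶠ i in atTop, dist (T^[i] y) x ≤ b}
  have hBlow : ∀ b ∈ B, 0 ≤ b := by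
    rintro b ⟨x, -, hx⟩
    obtain ⟨i, hi⟩ := hx.exists
    exact dist_nonneg.trans hi
  have hBne : B.Nonempty := by
    obtain ⟨D, hD⟩ := Metric.isBounded_iff.1 hbd
    exact ⟨D, y, hy, .of_forall fun i => hD (horb y hy i) hy⟩
  have hBbdd : BddBelow B := ⟨0, hBlow⟩
  rcases (Real.sInf_nonneg hBlow).eq_or_lt with hρ | hρ
  · obtain ⟨b, ⟨x, -, hx⟩, hb⟩ := exists_lt_of_csInf_lt hBne
      (show sInf B < ε / 2 by rw [← hρ]; linarith)
    obtain ⟨N, hN⟩ := eventually_atTop.1 hx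
    refine ⟨T^[N] y, horb y hy N, ?_⟩
    rw [← Function.iterate_succ_apply' T N y]
    linarith [dist_triangle_right (T^[N] y) (T^[N + 1] y) x, hN N le_rfl, hN (N + 1) (by omega)]
  · have hk1 := hk0 1
    have hε' : 0 < ε / (2 + k 1) := by positivity
    obtain ⟨δ, hδ, hclose⟩ := dist_lt_of_nearly_optimal_centers hUC hMon hconv
      (fun i => T^[i] y) hρ (fun b x hx hb => csInf_le hBbdd ⟨x, hx, hb⟩) hε'
    obtain ⟨b, ⟨x, hx, hxb⟩, hb⟩ := exists_lt_of_csInf_lt hBne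
      (show sInf B < sInf B + δ by linarith)
    have hlim : Tendsto (fun m => (1 + k m) * b) atTop (nhds b) := by
      simpa using (hklim.const_add 1).mul_const b
    obtain ⟨M, hM⟩ := eventually_atTop.1 (hlim.eventually (ge_mem_nhds hb))
    have hdist : ∀ m ≥ M, dist x (T^[m] x) < ε / (2 + k 1) := fun m hm => by
      refine hclose x hx _ (horb x hx m) (hxb.mono fun i hi => hi.trans hb.le) ?_
      obtain ⟨N, hN⟩ := eventually_atTop.1 hxb
      filter_upwards [eventually_ge_atTop (N + m)] with i hi
      obtain ⟨j, rfl⟩ : ∃ j, i = m + j := ⟨i - m, by omega⟩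
      rw [Function.iterate_add_apply]
      refine (hlip m _ (horb y hy j) x hx).trans (le_trans ?_ (hM m hm))
      have := hk0 m
      gcongr
      exact hN j (by omega)
    refine ⟨x, hx, ?_⟩
    have hT1 : dist (T^[M + 1] x) (T x) ≤ (1 + k 1) * dist x (T^[M] x) := by
      rw [Function.iterate_succ_apply' T M x, dist_comm x]
      exact hlip 1 _ (horb x hx M) x hx
    calc dist x (T x) ≤ dist x (T^[M + 1] x) + dist (T^[M + 1] x) (T x) := dist_triangle _ _ _
      _ ≤ dist x (T^[M + 1] x) + (1 + k 1) * dist x (T^[M] x) := by gcongr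
      _ < ε / (2 + k 1) + (1 + k 1) * (ε / (2 + k 1)) :=
        add_lt_add_of_lt_of_le (hdist _ (by omega)) (by gcongr; exact (hdist M le_rfl).le)
      _ = ε := by field_simp; ring
end

section
/- Let (X,d,W) be a uniformly convex hyperbolic space with a monotone modulus of uniform convexity η, C a nonempty convex subset of X, and T : C → C asymptotically nonexpansive with sequence (k_n). Assume K ≥ 0 satisfies Σ_{n=0}^∞ k_n ≤ K, and L ∈ ℕ with L ≥ 2 satisfies 1/L ≤ λ_n ≤ 1 − 1/L for all n ∈ ℕ. Let x ∈ C and b > 0 be such that for every δ > 0 there exists p ∈ C with d(x,p) ≤ b and d(Tp,p) ≤ δ. Then for all ε ∈ (0,1] and all g : ℕ → ℕ there exists N ≤ Φ(K,L,b,η,ε,g) such that d(x_m, T x_m) < ε for all m ∈ [N, N + g(N)], where Φ(K,L,b,η,ε,g) := h^M(0) with h(n) := g(n+1) + n + 2, M := ⌈3(5KD + D + 11/2)/θ⌉, D := e^K·(b + 2), θ := (ε/(L²·f(K)))·η((1+K)D + 1, ε/(f(K)·((1+K)D + 1))), and f(K) := 2(1 + (1+K)²(2+K)). Moreover, N = h^i(0)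 + 1 for some i < M. -/
open Filter Set

section Hyperbolic

variable {X : Type*}

theorem IsWMap.eq_of_dist_le [MetricSpace X] {W : X → X → ℝ → X} {η : ℝ → ℝ → ℝ}
    (hW : IsWMap W) (hUC : IsUCModulus W η) {x y u v : X} {t : ℝ} (ht : 0 < t)
    (hxy : 0 < dist x y)
    (hu : dist x u ≤ t * dist x y) (hu' : dist y u ≤ (1 - t) * dist x y)
    (hv : dist x v ≤ t * dist x y) (hv' : dist y v ≤ (1 - t) * dist x y) : u = v := by
  by_contra hne
  have huv : 0 < dist u v := dist_pos.mpr hne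
  have hr : 0 < t * dist x y := mul_pos ht hxy
  have huv2 : dist u v ≤ 2 * (t * dist x y) := by
    have := dist_triangle_left u v x
    linarith
  have hmem : dist u v / (t * dist x y) ∈ Set.Ioc (0 : ℝ) 2 :=
    ⟨div_pos huv hr, (div_le_iff₀ hr).2 huv2⟩
  have hη := (hUC.1 _ _ hr hmem).1
  have h1 := hUC.2 _ _ x u v hr hmem (by rwa [dist_comm]) (by rwa [dist_comm])
    (div_mul_cancel₀ _ hr.ne').le
  have h2 := hW.w1 u v y (1 / 2) (by norm_num)
  have h3 := dist_triangle_left x y (W u v (1 / 2))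
  rw [dist_comm (W u v (1 / 2)) y] at h3
  have h4 := mul_pos hη hr
  linarith

theorem IsWMap.dist_le_of_le_half [MetricSpace X] {W : X → X → ℝ → X} {η : ℝ → ℝ → ℝ}
    (hW : IsWMap W) (hUC : IsUCModulus W η) {x y a : X} {t r ε : ℝ} (ht : 0 < t)
    (ht2 : t ≤ 1 / 2) (hr : 0 < r) (hε : ε ∈ Set.Ioc (0 : ℝ) 2)
    (hx : dist x a ≤ r) (hy : dist y a ≤ r) (hxy : ε * r ≤ dist x y) :
    dist (W x y t) a ≤ (1 - 2 * t * η r ε) * r := by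
  have hd : 0 < dist x y := (mul_pos hε.1 hr).trans_le hxy
  have hhalf : (1 / 2 : ℝ) ∈ Set.Icc (0 : ℝ) 1 := by norm_num
  have htI : t ∈ Set.Icc (0 : ℝ) 1 := ⟨ht.le, by linarith⟩
  have ht2I : 2 * t ∈ Set.Icc (0 : ℝ) 1 := ⟨by linarith, by linarith⟩
  have e1 := hW.w1 x y x t htI
  have e2 := hW.w1 x y y t htI
  have f1 := hW.w1 x (W x y (1 / 2)) x (2 * t) ht2I
  have f2 := hW.w1 x (W x y (1 / 2)) y (2 * t) ht2I
  have m1 := mul_le_mul_of_nonneg_left (hW.w1 x y x (1 / 2) hhalf) ht2I.1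
  have m2 := mul_le_mul_of_nonneg_left (hW.w1 x y y (1 / 2) hhalf) ht2I.1
  simp only [dist_self, dist_comm y x] at e1 e2 f1 f2 m1 m2
  have heq : W x y t = W x (W x y (1 / 2)) (2 * t) := by
    apply hW.eq_of_dist_le hUC ht hd <;> linarith
  rw [heq, dist_comm]
  refine (hW.w1 _ _ _ _ ht2I).trans ?_
  rw [dist_comm a, dist_comm a]
  have g1 := mul_le_mul_of_nonneg_left (hUC.2 r ε a x y hr hε hx hy hxy) ht2I.1
  have g2 := mul_le_mul_of_nonneg_left hx (by linarith : 0 ≤ 1 - 2 * t)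
  linarith

theorem IsWMap.dist_le_of_uniformlyConvex [MetricSpace X] {W : X → X → ℝ → X} {η : ℝ → ℝ → ℝ}
    (hW : IsWMap W) (hUC : IsUCModulus W η) {x y a : X} {t r ε : ℝ} (ht : 0 < t)
    (ht1 : t < 1) (hr : 0 < r) (hε : ε ∈ Set.Ioc (0 : ℝ) 2)
    (hx : dist x a ≤ r) (hy : dist y a ≤ r) (hxy : ε * r ≤ dist x y) :
    dist (W x y t) a ≤ (1 - 2 * (t * (1 - t)) * η r ε) * r := by
  have hη := mul_pos (hUC.1 r ε hr hε).1 hr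
  rcases le_total t (1 / 2) with h | h
  · have h1 := hW.dist_le_of_le_half hUC ht h hr hε hx hy hxy
    have h2 := mul_nonneg (mul_nonneg ht.le ht.le) hη.le
    linarith
  · have h1 := hW.dist_le_of_le_half hUC (by linarith : 0 < 1 - t) (by linarith) hr hε hy hx
      (by rwa [dist_comm])
    rw [← hW.w3 x y t ⟨ht.le, ht1.le⟩] at h1
    have h2 := mul_nonneg (mul_nonneg (sub_pos.2 ht1).le (sub_pos.2 ht1).le) hη.le
    linarith

theorem IsWMap.dist_le_sub_of_uniformlyConvex [MetricSpace X] {W : X → X → ℝ → X}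
    {η : ℝ → ℝ → ℝ} (hW : IsWMap W) (hUC : IsUCModulus W η) (hMon : MonotoneUCModulus η)
    {x y a : X} {t r s c l : ℝ} (hl : 0 < l) (ht : l ≤ t) (ht1 : t ≤ 1 - l)
    (hc : 0 < c) (hs : 0 < s) (hcs : c / s ≤ 2) (hrs : r ≤ s)
    (hx : dist x a ≤ r) (hy : dist y a ≤ r) (hxy : c ≤ dist x y) :
    dist (W x y t) a ≤ r - c * l ^ 2 * η s (c / s) := by
  have hcr : c ≤ 2 * r := by
    have := dist_triangle_right x y a
    linarith
  have hr : 0 < r := by linarith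
  have hmem : c / s ∈ Set.Ioc (0 : ℝ) 2 := ⟨div_pos hc hs, hcs⟩
  have hsep : c / s * r ≤ dist x y := by
    refine le_trans ?_ hxy
    rw [div_mul_eq_mul_div, div_le_iff₀ hs]
    exact mul_le_mul_of_nonneg_left hrs hc.le
  have h1 := hW.dist_le_of_uniformlyConvex hUC (hl.trans_le ht) (by linarith) hr hmem hx hy hsep
  have hη := hMon _ hmem r s hr hrs
  have hη0 := (hUC.1 s _ hs hmem).1
  have hll : l ^ 2 ≤ t * (1 - t) := by
    rw [sq]
    exact mul_le_mul ht (by linarith) hl.le (by linarith)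
  have h2 : c * l ^ 2 * η s (c / s) ≤ (2 * r) * (t * (1 - t)) * η r (c / s) := by
    gcongr
    exact mul_nonneg (by linarith) ((sq_nonneg l).trans hll)
  linarith

theorem AsymptoticallyNonexpansive.dist_iterate_le [MetricSpace X] {C : Set X} {T : X → X}
    {k : ℕ → ℝ} (hT : AsymptoticallyNonexpansive C T k) {p : X} (hp : p ∈ C) (n : ℕ) :
    dist (T^[n] p) p ≤ (n + ∑ i ∈ Finset.range n, k i) * dist (T p) p := by
  induction n with
  | zero => simp
  | succ n ih =>
    rw [Function.iterate_succ_apply, Finset.sum_range_succ]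
    have h1 := dist_triangle (T^[n] (T p)) (T^[n] p) p
    have h2 := hT.2.2.2 n _ (hT.1 hp) _ hp
    push_cast
    linarith

theorem dist_map_le_of_dist_iterate_lt [MetricSpace X] {W : X → X → ℝ → X} (hW : IsWMap W)
    {C : Set X} {T : X → X} {k : ℕ → ℝ} (hT : AsymptoticallyNonexpansive C T k)
    {u : X} {t : ℝ} {n : ℕ} (hu : u ∈ C) (ht : t ∈ Set.Icc (0 : ℝ) 1)
    (hw : W u (T^[n] u) t ∈ C) :
    dist (W u (T^[n] u) t) (T (W u (T^[n] u) t)) ≤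
      dist (W u (T^[n] u) t) (T^[n + 1] (W u (T^[n] u) t)) +
        (1 + k 1) * ((1 + k n) * dist u (T^[n] u)) := by
  obtain ⟨hmaps, hk0, -, hlip⟩ := hT
  set w := W u (T^[n] u) t with hwdef
  have h1 := dist_triangle_right w (T w) (T^[n + 1] w)
  have h2 : dist (T w) (T^[n + 1] w) ≤ (1 + k 1) * dist w (T^[n] w) := by
    rw [Function.iterate_succ_apply']
    exact hlip 1 w hw _ (hmaps.iterate n hw)
  have h3 := dist_triangle w (T^[n] u) (T^[n] w)
  have h4 := hlip n u hu w hw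
  have h5 := hW.w1 u (T^[n] u) u t ht
  have h6 := hW.w1 u (T^[n] u) (T^[n] u) t ht
  simp only [dist_self, ← hwdef, dist_comm (T^[n] u) u] at h5 h6
  rw [dist_comm (T^[n] u) w] at h6
  have h7 : (1 + k n) * dist u w ≤ (1 + k n) * (t * dist u (T^[n] u)) :=
    mul_le_mul_of_nonneg_left (by linarith) (by linarith [hk0 n])
  have h8 : dist w (T^[n] w) ≤ (1 + k n) * dist u (T^[n] u) := by
    have := mul_nonneg (mul_nonneg (hk0 n) (sub_nonneg.2 ht.2))
      (dist_nonneg (x := u) (y := T^[n] u))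
    linarith
  have h9 := mul_le_mul_of_nonneg_left h8 (by linarith [hk0 1] : 0 ≤ 1 + k 1)
  linarith

end Hyperbolic

theorem le_exp_sum_mul_of_le_one_add_mul_add {a k : ℕ → ℝ} {b e : ℝ} {H : ℕ}
    (hk : ∀ n, 0 ≤ k n) (hb : 0 ≤ b) (he : 0 ≤ e) (h0 : a 0 ≤ b)
    (hstep : ∀ n < H, a (n + 1) ≤ (1 + k n) * a n + e) (n : ℕ) (hn : n ≤ H) :
    a n ≤ Real.exp (∑ i ∈ Finset.range n, k i) * (b + n * e) := by
  induction n with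
  | zero => simpa using h0
  | succ n ih =>
    have h1 := hstep n hn
    have h2 := mul_le_mul_of_nonneg_left (ih (by omega)) (by linarith [hk n] : 0 ≤ 1 + k n)
    rw [Finset.sum_range_succ, Real.exp_add]
    have hS : 0 ≤ ∑ i ∈ Finset.range n, k i := Finset.sum_nonneg fun i _ => hk i
    set E := Real.exp (∑ i ∈ Finset.range n, k i)
    have hE : 1 ≤ E := Real.one_le_exp hS
    have hF : 1 + k n ≤ Real.exp (k n) := by linarith [Real.add_one_le_exp (k n)]
    have hEF : 1 ≤ E * Real.exp (k n) := one_le_mul_of_one_le_of_one_le hE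
      (Real.one_le_exp (hk n))
    have h3 : (1 + k n) * (E * (b + n * e)) ≤ Real.exp (k n) * (E * (b + n * e)) :=
      mul_le_mul_of_nonneg_right hF (by positivity)
    have h4 := mul_le_mul_of_nonneg_right hEF he
    push_cast
    linarith

theorem add_mul_le_of_drop_on_blocks {u : ℕ → ℝ} {h : ℕ → ℕ} {θ : ℝ} {M : ℕ}
    (hh : ∀ n, n < h n) (hu : ∀ n < h^[M] 0, u (n + 1) ≤ u n)
    (hdrop : ∀ i < M, ∃ n, h^[i] 0 ≤ n ∧ n < h^[i + 1] 0 ∧ u (n + 1) ≤ u n - θ) :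
    u (h^[M] 0) + M * θ ≤ u 0 := by
  have hmono : Monotone fun i => h^[i] 0 := monotone_nat_of_le_succ fun i => by
    rw [Function.iterate_succ_apply']
    exact (hh _).le
  have hanti : ∀ m n, m ≤ n → n ≤ h^[M] 0 → u n ≤ u m := by
    intro m n hmn
    induction n, hmn using Nat.le_induction with
    | base => exact fun _ => le_rfl
    | succ n _ ih => exact fun hn => (hu n hn).trans (ih (by omega))
  suffices ∀ i ≤ M, u (h^[i] 0) + i * θ ≤ u 0 from this M le_rfl
  intro i
  induction i with
  | zero => simp
  | succ i ih =>
    intro hi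
    obtain ⟨n, hn1, hn2, hn3⟩ := hdrop i hi
    have hle : h^[i + 1] 0 ≤ h^[M] 0 := hmono hi
    have h1 := hanti _ _ hn1 (by omega)
    have h2 := hanti (n + 1) _ hn2 hle
    have h3 := ih (by omega)
    push_cast
    linarith

/-- quantitative asymptotic regularity (metastability) for Krasnoselski–Mann
iterations of asymptotically nonexpansive mappings in uniformly convex hyperbolic spaces. -/
theorem metastability_KM_asymptotically_nonexpansive
    {X : Type*} [MetricSpace X]
    (W : X → X → ℝ → X) (η : ℝ → ℝ → ℝ)
    (hW : IsWMap W) (hUC : IsUCModulus W η) (hMon : MonotoneUCModulus η)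
    (C : Set X) (hne : C.Nonempty) (hconv : WConvex W C)
    (T : X → X) (k : ℕ → ℝ) (hT : AsymptoticallyNonexpansive C T k)
    (K : ℝ) (hK : 0 ≤ K) (hsum : ∀ n : ℕ, ∑ i ∈ Finset.range n, k i ≤ K)
    (L : ℕ) (hL : 2 ≤ L) (lam : ℕ → ℝ)
    (hlam : ∀ n, 1 / (L : ℝ) ≤ lam n ∧ lam n ≤ 1 - 1 / (L : ℝ))
    (x : X) (hx : x ∈ C) (b : ℝ) (hb : 0 < b)
    (happ : ∀ δ > (0:ℝ), ∃ p ∈ C, dist x p ≤ b ∧ dist (T p) p ≤ δ)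
    (xseq : ℕ → X) (hKM : IsKMIteration W T lam x xseq)
    (ε : ℝ) (hε : 0 < ε) (hε1 : ε ≤ 1) (g : ℕ → ℕ)
    (fK D θ : ℝ) (h : ℕ → ℕ) (M Φ : ℕ)
    (hfK : fK = 2 * (1 + (1 + K) ^ 2 * (2 + K)))
    (hD : D = Real.exp K * (b + 2))
    (hθ : θ = ε / ((L : ℝ) ^ 2 * fK) * η ((1 + K) * D + 1) (ε / (fK * ((1 + K) * D + 1))))
    (hh : ∀ n, h n = g (n + 1) + n + 2)
    (hM : M = ⌈3 * (5 * K * D + D + 11 / 2) / θ⌉₊)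
    (hΦ : Φ = h^[M] 0) :
    ∃ N ≤ Φ, (∀ m, N ≤ m → m ≤ N + g N → dist (xseq m) (T (xseq m)) < ε) ∧
      ∃ i < M, N = h^[i] 0 + 1 := by
  obtain ⟨hx0, hstepx⟩ := hKM
  obtain ⟨hmaps, hk0, -, hlip⟩ := id hT
  have hLpos : (0 : ℝ) < L := by exact_mod_cast (by omega : 0 < L)
  have hl : (0 : ℝ) < 1 / L := one_div_pos.2 hLpos
  have hlamI : ∀ n, lam n ∈ Set.Icc (0 : ℝ) 1 := fun n =>
    ⟨hl.le.trans (hlam n).1, by linarith [(hlam n).2]⟩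
  have hxC : ∀ n, xseq n ∈ C := by
    intro n
    induction n with
    | zero => rwa [hx0]
    | succ n ih => rw [hstepx]; exact hconv _ ih _ (hmaps.iterate n ih) _ (hlamI n)
  have hkK : ∀ n, k n ≤ K := fun n => by
    have h1 := hsum (n + 1)
    rw [Finset.sum_range_succ] at h1
    linarith [Finset.sum_nonneg fun i (_ : i ∈ Finset.range n) => hk0 i]
  have hlt : ∀ n, n < h n := fun n => by rw [hh]; omega
  have hmono : Monotone fun i => h^[i] 0 := monotone_nat_of_le_succ fun i => by
    rw [Function.iterate_succ_apply']
    exact (hlt _).le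
  have hfK2 : 2 + 2 * ((1 + K) * (1 + K)) ≤ fK := by
    rw [hfK]
    nlinarith [mul_nonneg (sq_nonneg (1 + K)) (by linarith : 0 ≤ 1 + K)]
  have hfKge : 2 ≤ fK := by nlinarith [mul_self_nonneg (1 + K)]
  have hfKpos : 0 < fK := by linarith
  have hDb : b + 2 ≤ D := by
    rw [hD]
    exact le_mul_of_one_le_left (by linarith) (Real.one_le_exp hK)
  have hKD : 0 ≤ K * D := mul_nonneg hK (by linarith)
  set s := (1 + K) * D + 1 with hs
  have hs1 : 1 ≤ s := by linarith
  set c := ε / fK with hcdef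
  have hc : 0 < c := div_pos hε hfKpos
  have hcs : c / s ≤ 2 := by
    have h1 : c ≤ 1 := (div_le_one hfKpos).2 (by linarith)
    exact (div_le_one (by linarith)).2 (by linarith) |>.trans one_le_two
  have hθ' : θ = c * (1 / (L : ℝ)) ^ 2 * η s (c / s) := by
    rw [hθ, hcdef, div_div ε fK s]
    congr 1
    field_simp
  have hθpos : 0 < θ := by
    rw [hθ']
    have := (hUC.1 s (c / s) (by linarith) ⟨by positivity, hcs⟩).1
    positivity
  suffices ∃ i < M, ∀ n, h^[i] 0 ≤ n → n < h^[i + 1] 0 →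
      dist (xseq n) (T^[n] (xseq n)) < c by
    obtain ⟨i, hi, hsmall⟩ := this
    have hsucc : h^[i + 1] 0 = g (h^[i] 0 + 1) + h^[i] 0 + 2 := by
      rw [Function.iterate_succ_apply', hh]
    have hle : h^[i + 1] 0 ≤ h^[M] 0 := hmono hi
    refine ⟨h^[i] 0 + 1, by omega, fun m hm1 hm2 => ?_, i, hi, rfl⟩
    obtain ⟨n, rfl⟩ : ∃ n, m = n + 1 := ⟨m - 1, by omega⟩
    have h1 := dist_map_le_of_dist_iterate_lt hW hT (hxC n) (hlamI n)
      (by rw [← hstepx]; exact hxC _)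
    rw [← hstepx] at h1
    have h2 := hsmall n (by omega) (by omega)
    have h3 := hsmall (n + 1) (by omega) (by omega)
    have h4 : (1 + k 1) * ((1 + k n) * dist (xseq n) (T^[n] (xseq n))) ≤
        (1 + K) * ((1 + K) * c) := by
      have hk1 := hk0 1
      have hkn := hk0 n
      have hk1' := hkK 1
      have hkn' := hkK n
      gcongr
    have h5 : (2 + 2 * ((1 + K) * (1 + K))) * c ≤ ε := by
      calc _ ≤ fK * c := mul_le_mul_of_nonneg_right hfK2 hc.le
        _ = ε := mul_div_cancel₀ _ hfKpos.ne'
    have h6 : 0 ≤ (1 + K) * ((1 + K) * c) := by positivity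
    linarith
  by_contra! hcon
  obtain ⟨e, he, heH, happrox⟩ : ∃ e : ℝ, 0 ≤ e ∧ (∀ n ≤ h^[M] 0, (n : ℝ) * e ≤ 1) ∧
      e ≤ 1 ∧ ∃ p ∈ C, dist x p ≤ b ∧ ∀ n ≤ h^[M] 0, dist (T^[n] p) p ≤ e := by
    set H := h^[M] 0
    have hA : (0 : ℝ) < H + K + 1 := by positivity
    have hB : (0 : ℝ) < H + 1 := by positivity
    obtain ⟨p, hp, hxp, hTp⟩ := happ (1 / (H + 1) / (H + K + 1)) (by positivity)
    refine ⟨1 / (H + 1), by positivity, fun n hn => ?_, ?_, p, hp, hxp, fun n hn => ?_⟩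
    · have : (n : ℝ) ≤ H := by exact_mod_cast hn
      rw [mul_one_div, div_le_one hB]
      linarith
    · rw [div_le_one hB]
      linarith [(Nat.cast_nonneg H : (0 : ℝ) ≤ H)]
    · have hnH : (n : ℝ) ≤ H := by exact_mod_cast hn
      calc _ ≤ _ := hT.dist_iterate_le hp n
        _ ≤ (H + K + 1) * (1 / (H + 1) / (H + K + 1)) :=
          mul_le_mul (by linarith [hsum n]) hTp dist_nonneg hA.le
        _ = 1 / (H + 1) := mul_div_cancel₀ _ hA.ne'
  obtain ⟨he1, p, hp, hxp, hTp⟩ := happrox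
  have hTx : ∀ n ≤ h^[M] 0,
      dist (T^[n] (xseq n)) p ≤ (1 + k n) * dist (xseq n) p + e := fun n hn =>
    (dist_triangle _ (T^[n] p) p).trans (add_le_add (hlip n _ (hxC n) _ hp) (hTp n hn))
  have hself : ∀ n, dist (xseq n) p ≤ (1 + k n) * dist (xseq n) p + e := fun n => by
    linarith [mul_nonneg (hk0 n) (dist_nonneg (x := xseq n) (y := p))]
  have hgrow : ∀ n < h^[M] 0, dist (xseq (n + 1)) p ≤ (1 + k n) * dist (xseq n) p + e := by
    intro n hn
    have h1 := hW.w1 (xseq n) (T^[n] (xseq n)) p (lam n) (hlamI n)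
    rw [← hstepx, dist_comm p, dist_comm p, dist_comm p] at h1
    have h2 := mul_le_mul_of_nonneg_left (hTx n hn.le) (hlamI n).1
    have h3 := mul_le_mul_of_nonneg_left (hself n) (sub_nonneg.2 (hlamI n).2)
    linarith
  have hbdd : ∀ n ≤ h^[M] 0, dist (xseq n) p ≤ D := by
    intro n hn
    refine (le_exp_sum_mul_of_le_one_add_mul_add (a := fun n => dist (xseq n) p) hk0 hb.le he
      (by rwa [hx0]) hgrow n hn).trans ?_
    rw [hD]
    have := heH n hn
    have := hsum n
    gcongr
    linarith
  have hkD : ∀ n ≤ h^[M] 0, k n * dist (xseq n) p ≤ k n * D := fun n hn =>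
    mul_le_mul_of_nonneg_left (hbdd n hn) (hk0 n)
  have hmain := add_mul_le_of_drop_on_blocks
    (u := fun n => dist (xseq n) p - (∑ i ∈ Finset.range n, k i) * D - n * e) (θ := θ) (M := M)
    hlt ?_ ?_
  · have h1 : 3 * (5 * K * D + D + 11 / 2) ≤ M * θ := by
      rw [← div_le_iff₀ hθpos, hM]
      exact Nat.le_ceil _
    have h2 := heH _ le_rfl
    have h3 := mul_le_mul_of_nonneg_right (hsum (h^[M] 0)) (by linarith : 0 ≤ D)
    have h4 := dist_nonneg (x := xseq (h^[M] 0)) (y := p)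
    simp only [hx0, Finset.range_zero, Finset.sum_empty, Nat.cast_zero] at hmain
    linarith
  · intro n hn
    have h1 := hgrow n hn
    have h2 := hkD n hn.le
    simp only [Finset.sum_range_succ]
    push_cast
    linarith
  · intro i hi
    obtain ⟨n, hn1, hn2, hn3⟩ := hcon i hi
    refine ⟨n, hn1, hn2, ?_⟩
    have hle : h^[i + 1] 0 ≤ h^[M] 0 := hmono hi
    have hn : n ≤ h^[M] 0 := by omega
    have h2 := hkD n hn
    have h3 := mul_le_mul_of_nonneg_right (hkK n) (by linarith : 0 ≤ D)
    have h1 := hW.dist_le_sub_of_uniformlyConvex hUC hMon hl (hlam n).1 (hlam n).2 hc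
      (by linarith : 0 < s) hcs (by linarith [hbdd n hn]) (hself n) (hTx n hn) hn3
    rw [← hstepx, ← hθ'] at h1
    simp only [Finset.sum_range_succ]
    push_cast
    linarith
end

section
/- Let (X,d,W) be a hyperbolic space which is uniformly convex with the (monotone) modulus of uniform convexity η(r,ε) := ε²/8 (as holds in any CAT(0)-space), C a nonempty convex bounded subset of X with diameter at most d_C > 0, and T : C → C asymptotically nonexpansive with sequence (k_n). Assume K ≥ 0 satisfies Σ_{n=0}^∞ k_n ≤ K and L ∈ ℕ, L ≥ 2, satisfies 1/L ≤ λ_n ≤ 1 − 1/L for all n. Then T is λ_n-asymptotically regular, and for every x ∈ C and every ε ∈ (0,1] there exists N ≤ 2M with d(x_N, T x_N) < ε, where M := ⌈(1/ε²)·24L²·(5KD + D + 11/2)·(f(K))³·((1+K)D + 1)²⌉, D := e^K·(d_C + 2), and f(K) := 2(1 + (1+K)²(2+K)). In particular, one obtains an approximate fixed point bound quadratic in 1/ε. -/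
open Filter Set

section KrasnoselskiMann

variable {X : Type*} [MetricSpace X] {W : X → X → ℝ → X} {C : Set X} {T : X → X} {k : ℕ → ℝ}

theorem IsWMap.dist_left_le (hW : IsWMap W) (x y : X) {t : ℝ} (ht : t ∈ Set.Icc (0 : ℝ) 1) :
    dist x (W x y t) ≤ t * dist x y := by
  simpa using hW.w1 x y x t ht

theorem IsWMap.dist_right_le (hW : IsWMap W) (x y : X) {t : ℝ} (ht : t ∈ Set.Icc (0 : ℝ) 1) :
    dist (W x y t) y ≤ (1 - t) * dist x y := by
  simpa [dist_comm] using hW.w1 x y y t ht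

theorem IsWMap.dist_le (hW : IsWMap W) {x y a : X} {r t : ℝ} (ht : t ∈ Set.Icc (0 : ℝ) 1)
    (hx : dist x a ≤ r) (hy : dist y a ≤ r) : dist (W x y t) a ≤ r := by
  have h := hW.w1 x y a t ht
  rw [dist_comm a x, dist_comm a y, dist_comm a] at h
  nlinarith [mul_le_mul_of_nonneg_left hx (sub_nonneg.2 ht.2),
    mul_le_mul_of_nonneg_left hy ht.1]

/-- Midpoint estimate for the modulus `ε ^ 2 / 8`, with the parameter `ε` eliminated. -/
theorem IsUCModulus.dist_midpoint_le (hW : IsWMap W)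
    (hUC : IsUCModulus W (fun _ ε => ε ^ 2 / 8))
    {x y a : X} {r : ℝ} (hr : 0 < r) (hx : dist x a ≤ r) (hy : dist y a ≤ r) :
    dist (W x y (1 / 2)) a ≤ r - dist x y ^ 2 / (8 * r) := by
  rcases eq_or_ne x y with rfl | hxy
  · simpa using hW.dist_le (t := 1 / 2) (by norm_num) hx hx
  · have hd : 0 < dist x y := dist_pos.mpr hxy
    have hd2 : dist x y ≤ 2 * r := by
      have := dist_triangle_right x y a
      linarith
    have h := hUC.2 r (dist x y / r) a x y hr
      ⟨by positivity, by rw [div_le_iff₀ hr]; exact hd2⟩ hx hy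
      (by rw [div_mul_cancel₀ _ hr.ne'])
    refine h.trans_eq ?_
    field_simp

theorem IsUCModulus.eq_of_dist_le (hW : IsWMap W)
    (hUC : IsUCModulus W (fun _ ε => ε ^ 2 / 8))
    {x y z z' : X} {s t : ℝ} (hst : s + t ≤ dist x y) (hz : dist x z ≤ s) (hzy : dist z y ≤ t)
    (hz' : dist x z' ≤ s) (hzy' : dist z' y ≤ t) : z = z' := by
  by_contra hne
  have hs : 0 < s := by
    refine lt_of_le_of_ne (dist_nonneg.trans hz) fun h0 => hne ?_
    subst h0
    exact (dist_le_zero.1 hz).symm.trans (dist_le_zero.1 hz')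
  rw [dist_comm] at hz hz'
  have hmid := hUC.dist_midpoint_le hW hs hz hz'
  have hpos : 0 < dist z z' ^ 2 / (8 * s) := by
    have := dist_pos.2 hne
    positivity
  have hmid' := hW.dist_le (t := 1 / 2) (by norm_num) hzy hzy'
  have htri := dist_triangle_left x y (W z z' (1 / 2))
  linarith

theorem IsUCModulus.eq_midpoint (hW : IsWMap W)
    (hUC : IsUCModulus W (fun _ ε => ε ^ 2 / 8))
    (x y : X) {t : ℝ} (ht0 : 0 ≤ t) (ht : t ≤ 1 / 2) :
    W x y t = W x (W x y (1 / 2)) (2 * t) := by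
  have ht1 : t ∈ Set.Icc (0 : ℝ) 1 := ⟨ht0, by linarith⟩
  have ht2 : 2 * t ∈ Set.Icc (0 : ℝ) 1 := ⟨by linarith, by linarith⟩
  have hhalf : (1 / 2 : ℝ) ∈ Set.Icc (0 : ℝ) 1 := by norm_num
  have hm := hW.dist_left_le x y hhalf
  have hm' := hW.dist_right_le x y hhalf
  refine hUC.eq_of_dist_le hW (s := t * dist x y) (t := (1 - t) * dist x y) (by linarith)
    (hW.dist_left_le x y ht1) (hW.dist_right_le x y ht1) ?_ ?_
  · nlinarith [hW.dist_left_le x (W x y (1 / 2)) ht2]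
  · have h := hW.w1 x (W x y (1 / 2)) y (2 * t) ht2
    rw [dist_comm y, dist_comm y x, dist_comm y] at h
    nlinarith

/-- Estimate for arbitrary convex combinations bounded away from the end points. -/
theorem IsUCModulus.dist_le (hW : IsWMap W)
    (hUC : IsUCModulus W (fun _ ε => ε ^ 2 / 8))
    {x y a : X} {r l t : ℝ} (hl : 0 ≤ l) (hlt : l ≤ t) (htl : t ≤ 1 - l)
    (hr : 0 < r) (hx : dist x a ≤ r) (hy : dist y a ≤ r) :
    dist (W x y t) a ≤ r - 2 * l * (dist x y ^ 2 / (8 * r)) := by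
  wlog ht : t ≤ 1 / 2 generalizing x y t
  · rw [hW.w3 x y t ⟨by linarith, by linarith⟩, dist_comm x y]
    exact this (by linarith) (by linarith) hy hx (by linarith)
  rw [hUC.eq_midpoint hW x y (hl.trans hlt) ht]
  have h := hW.w1 x (W x y (1 / 2)) a (2 * t) ⟨by linarith, by linarith⟩
  rw [dist_comm a, dist_comm a x, dist_comm a] at h
  have hm := hUC.dist_midpoint_le hW hr hx hy
  have hq : 0 ≤ dist x y ^ 2 / (8 * r) := by positivity
  have h1 := mul_le_mul_of_nonneg_left hx (show 0 ≤ 1 - 2 * t by linarith)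
  have h2 := mul_le_mul_of_nonneg_left hm (show 0 ≤ 2 * t by linarith)
  have h3 := mul_le_mul_of_nonneg_right hlt hq
  linarith

/-- Points of `C` that nearly minimise the asymptotic radius of an orbit are moved little by all
high iterates of `T`. -/
theorem AsymptoticallyNonexpansive.exists_forall_ge_dist_iterate_le
    (hT : AsymptoticallyNonexpansive C T k) (hW : IsWMap W)
    (hUC : IsUCModulus W (fun _ ε => ε ^ 2 / 8)) (hne : C.Nonempty) (hconv : WConvex W C)
    {d : ℝ} (hdiam : ∀ p ∈ C, ∀ q ∈ C, dist p q ≤ d) {δ : ℝ} (hδ : 0 < δ) :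
    ∃ p ∈ C, ∃ m₀, ∀ m ≥ m₀, dist (T^[m] p) p ≤ δ := by
  obtain ⟨hmaps, hk0, hklim, hlip⟩ := hT
  obtain ⟨y, hy⟩ := hne
  have hd : 0 ≤ d := dist_nonneg.trans (hdiam y hy y hy)
  set A : Set ℝ := {b | ∃ p ∈ C, ∀ᶠ n in atTop, dist p (T^[n] y) ≤ b}
  have hA0 : ∀ b ∈ A, 0 ≤ b := by
    rintro b ⟨p, -, hp⟩
    obtain ⟨n, hn⟩ := hp.exists
    exact dist_nonneg.trans hn
  have hAbdd : BddBelow A := ⟨0, hA0⟩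
  have hdA : d ∈ A := ⟨y, hy, .of_forall fun n => hdiam _ hy _ (hmaps.iterate n hy)⟩
  set ρ := sInf A
  have hρ0 : 0 ≤ ρ := le_csInf ⟨d, hdA⟩ hA0
  have hρd : ρ ≤ d := csInf_le hAbdd hdA
  obtain ⟨γ, hγ, hγ1, hγδ⟩ : ∃ γ : ℝ, 0 < γ ∧ γ ≤ 1 ∧ 8 * (d + 1) * γ ≤ δ ^ 2 := by
    refine ⟨min 1 (δ ^ 2 / (8 * (d + 1))), by positivity, min_le_left _ _, ?_⟩
    have := min_le_right 1 (δ ^ 2 / (8 * (d + 1)))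
    rwa [le_div_iff₀' (by positivity)] at this
  obtain ⟨b, hbA, hb⟩ := exists_lt_of_csInf_lt ⟨d, hdA⟩ (show sInf A < ρ + γ / 2 by linarith)
  have hb0 := hA0 b hbA
  obtain ⟨p, hp, hpb⟩ := hbA
  obtain ⟨m₀, hm₀⟩ := eventually_atTop.1
    (hklim.eventually_lt_const (show 0 < γ / 2 / (d + 1) by positivity))
  refine ⟨p, hp, m₀, fun m hm => ?_⟩
  have hkm : k m * (d + 1) < γ / 2 := (lt_div_iff₀ (by positivity)).1 (hm₀ m hm)
  have hR : 0 < ρ + γ := by positivity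
  have hmid : ρ ≤ ρ + γ - dist (T^[m] p) p ^ 2 / (8 * (ρ + γ)) := by
    refine csInf_le hAbdd ⟨W (T^[m] p) p (1 / 2),
      hconv _ (hmaps.iterate m hp) _ hp _ (by norm_num), ?_⟩
    obtain ⟨n₀, hn₀⟩ := eventually_atTop.1 hpb
    refine eventually_atTop.2 ⟨n₀ + m, fun n hn => ?_⟩
    refine hUC.dist_midpoint_le hW hR ?_ ((hn₀ n (by omega)).trans (by linarith))
    obtain ⟨j, rfl⟩ : ∃ j, n = m + j := ⟨n - m, by omega⟩
    rw [Function.iterate_add_apply]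
    refine (hlip m p hp _ (hmaps.iterate j hy)).trans ?_
    have h1 := mul_le_mul_of_nonneg_left (hn₀ j (by omega)) (hk0 m)
    have h2 := mul_le_mul_of_nonneg_left (show b ≤ d + 1 by linarith) (hk0 m)
    linarith [hn₀ j (by omega)]
  have hsq : dist (T^[m] p) p ^ 2 ≤ γ * (8 * (ρ + γ)) :=
    (div_le_iff₀ (by positivity)).1 (by linarith)
  refine le_of_sq_le_sq ?_ hδ.le
  nlinarith

theorem AsymptoticallyNonexpansive.exists_forall_dist_iterate_le
    (hT : AsymptoticallyNonexpansive C T k) (hW : IsWMap W)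
    (hUC : IsUCModulus W (fun _ ε => ε ^ 2 / 8)) (hne : C.Nonempty) (hconv : WConvex W C)
    {d : ℝ} (hdiam : ∀ p ∈ C, ∀ q ∈ C, dist p q ≤ d)
    {K : ℝ} (hkK : ∀ n, k n ≤ K) {δ : ℝ} (hδ : 0 < δ) :
    ∃ p ∈ C, ∀ j, dist (T^[j] p) p ≤ δ := by
  have hK : 0 ≤ K := (hT.2.1 0).trans (hkK 0)
  obtain ⟨p, hp, m, hm⟩ := hT.exists_forall_ge_dist_iterate_le hW hUC hne hconv hdiam
    (show 0 < δ / (2 + K) by positivity)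
  refine ⟨p, hp, fun j => ?_⟩
  have h1 := hT.2.2.2 j p hp _ (hT.1.iterate m hp)
  rw [← Function.iterate_add_apply, dist_comm p] at h1
  have h2 := hm m le_rfl
  have h3 := hm (j + m) (by omega)
  have h4 := dist_triangle (T^[j] p) (T^[j + m] p) p
  have h5 : (1 + k j) * dist (T^[m] p) p ≤ (1 + K) * (δ / (2 + K)) := by
    have := hkK j
    gcongr
  have h6 : (2 + K) * (δ / (2 + K)) = δ := mul_div_cancel₀ _ (by positivity)
  linarith

theorem IsKMIteration.mem {lam : ℕ → ℝ} {x : X} {u : ℕ → X} (hu : IsKMIteration W T lam x u)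
    (hconv : WConvex W C) (hmaps : Set.MapsTo T C C) (hx : x ∈ C)
    (hlam : ∀ n, lam n ∈ Set.Icc (0 : ℝ) 1) (n : ℕ) : u n ∈ C := by
  induction n with
  | zero => rwa [hu.1]
  | succ n ih =>
    rw [hu.2]
    exact hconv _ ih _ (hmaps.iterate n ih) _ (hlam n)

theorem IsKMIteration.sum_sq_dist_le {lam : ℕ → ℝ} {x : X} {u : ℕ → X}
    (hu : IsKMIteration W T lam x u) (hT : AsymptoticallyNonexpansive C T k) (hW : IsWMap W)
    (hUC : IsUCModulus W (fun _ ε => ε ^ 2 / 8)) (hconv : WConvex W C) (hx : x ∈ C)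
    {d : ℝ} (hdiam : ∀ p ∈ C, ∀ q ∈ C, dist p q ≤ d)
    {K : ℝ} (hsum : ∀ n : ℕ, ∑ i ∈ Finset.range n, k i ≤ K) (hkK : ∀ n, k n ≤ K)
    {l : ℝ} (hl : 0 < l) (hlam : ∀ n, l ≤ lam n ∧ lam n ≤ 1 - l) (n : ℕ) :
    l * ∑ i ∈ Finset.range n, dist (u i) (T^[i] (u i)) ^ 2 ≤ 4 * ((1 + K) * d) ^ 2 := by
  have hmem := hu.mem hconv hT.1 hx fun n =>
    ⟨by linarith [(hlam n).1], by linarith [(hlam n).2]⟩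
  have hK : 0 ≤ K := (hT.2.1 0).trans (hkK 0)
  have hd : 0 ≤ d := dist_nonneg.trans (hdiam x hx x hx)
  have key : ∀ δ : ℝ, 0 < δ → l * ∑ i ∈ Finset.range n, dist (u i) (T^[i] (u i)) ^ 2 ≤
      4 * ((1 + K) * d + δ) * ((1 + K) * d + n * δ) := by
    intro δ hδ
    obtain ⟨p, hp, hpδ⟩ :=
      hT.exists_forall_dist_iterate_le hW hUC ⟨x, hx⟩ hconv hdiam hkK hδ
    have hR : 0 < (1 + K) * d + δ := by positivity
    have step : ∀ i, l * dist (u i) (T^[i] (u i)) ^ 2 / (4 * ((1 + K) * d + δ)) ≤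
        dist (u i) p - dist (u (i + 1)) p + k i * d + δ := by
      intro i
      have hk0 := hT.2.1 i
      have hdi := hdiam _ (hmem i) _ hp
      have hkd : k i * dist (u i) p ≤ k i * d := by gcongr
      have hkKd : k i * d ≤ K * d := by
        have := hkK i
        gcongr
      have hTi : dist (T^[i] (u i)) p ≤ dist (u i) p + k i * d + δ := by
        have h1 := dist_triangle (T^[i] (u i)) (T^[i] p) p
        have h2 := hT.2.2.2 i _ (hmem i) _ hp
        linarith [hpδ i]
      have hr : 0 < dist (u i) p + k i * d + δ := by positivity
      have hui : dist (u i) p ≤ dist (u i) p + k i * d + δ := by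
        have : 0 ≤ k i * d := by positivity
        linarith
      have h := hUC.dist_le hW hl.le (hlam i).1 (hlam i).2 hr hui hTi
      rw [← hu.2] at h
      have hle : l * dist (u i) (T^[i] (u i)) ^ 2 / (4 * ((1 + K) * d + δ)) ≤
          l * dist (u i) (T^[i] (u i)) ^ 2 / (4 * (dist (u i) p + k i * d + δ)) := by
        gcongr
        linarith
      have heq : 2 * l * (dist (u i) (T^[i] (u i)) ^ 2 / (8 * (dist (u i) p + k i * d + δ))) =
          l * dist (u i) (T^[i] (u i)) ^ 2 / (4 * (dist (u i) p + k i * d + δ)) := by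
        field_simp
        ring
      linarith
    have hS := Finset.sum_le_sum fun i (_ : i ∈ Finset.range n) => step i
    simp only [Finset.sum_add_distrib, Finset.sum_range_sub', ← Finset.sum_div, ← Finset.mul_sum,
      ← Finset.sum_mul, Finset.sum_const, Finset.card_range, nsmul_eq_mul] at hS
    rw [div_le_iff₀ (by positivity)] at hS
    have h0 := hdiam _ (hmem 0) _ hp
    have hs := mul_le_mul_of_nonneg_right (hsum n) hd
    refine hS.trans ?_
    rw [mul_comm]
    gcongr
    linarith [dist_nonneg (x := u n) (y := p)]
  have hlim : Tendsto (fun δ : ℝ => 4 * ((1 + K) * d + δ) * ((1 + K) * d + n * δ))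
      (nhdsWithin 0 (Set.Ioi 0)) (nhds (4 * ((1 + K) * d) ^ 2)) := by
    have hc : Continuous fun δ : ℝ => 4 * ((1 + K) * d + δ) * ((1 + K) * d + n * δ) := by
      fun_prop
    convert (hc.tendsto 0).mono_left nhdsWithin_le_nhds using 2
    ring
  exact ge_of_tendsto hlim (eventually_nhdsWithin_of_forall key)

theorem IsKMIteration.dist_map_le {lam : ℕ → ℝ} {x : X} {u : ℕ → X}
    (hu : IsKMIteration W T lam x u) (hT : AsymptoticallyNonexpansive C T k) (hW : IsWMap W)
    (hmem : ∀ n, u n ∈ C) {K : ℝ} (hkK : ∀ n, k n ≤ K)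
    (hlam : ∀ n, lam n ∈ Set.Icc (0 : ℝ) 1) (n : ℕ) :
    dist (u (n + 1)) (T (u (n + 1))) ≤ dist (u (n + 1)) (T^[n + 1] (u (n + 1))) +
      (1 + K) ^ 2 * dist (u n) (T^[n] (u n)) := by
  obtain ⟨hmaps, hk0, -, hlip⟩ := hT
  have hK : 0 ≤ K := (hk0 0).trans (hkK 0)
  set c := dist (u n) (T^[n] (u n))
  have hc0 : 0 ≤ c := dist_nonneg
  have hleft : dist (u (n + 1)) (u n) ≤ lam n * c := by
    rw [dist_comm, hu.2]
    exact hW.dist_left_le _ _ (hlam n)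
  have hright : dist (T^[n] (u n)) (u (n + 1)) ≤ (1 - lam n) * c := by
    rw [dist_comm, hu.2]
    exact hW.dist_right_le _ _ (hlam n)
  have hmid : dist (T^[n] (u (n + 1))) (u (n + 1)) ≤ (1 + K) * c := by
    have h1 := dist_triangle (T^[n] (u (n + 1))) (T^[n] (u n)) (u (n + 1))
    have h2 : dist (T^[n] (u (n + 1))) (T^[n] (u n)) ≤ (1 + K) * (lam n * c) := by
      refine (hlip n _ (hmem (n + 1)) _ (hmem n)).trans ?_
      have := hkK n
      gcongr
    have h3 := mul_le_mul_of_nonneg_left (mul_le_mul_of_nonneg_right (hlam n).2 hc0) hK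
    linarith
  have hlast : dist (T^[n + 1] (u (n + 1))) (T (u (n + 1))) ≤ (1 + K) * ((1 + K) * c) := by
    have h := hlip 1 _ (hmaps.iterate n (hmem (n + 1))) _ (hmem (n + 1))
    rw [Function.iterate_succ_apply']
    refine h.trans ?_
    have := hkK 1
    gcongr
  have := dist_triangle (u (n + 1)) (T^[n + 1] (u (n + 1))) (T (u (n + 1)))
  linarith

end KrasnoselskiMann

/-- the CAT(0) case, with modulus `η(r,ε) = ε²/8`: a quadratic (in `1/ε`)
approximate fixed point bound. -/
theorem asymptotic_regularity_bounded_C_CAT0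
    {X : Type*} [MetricSpace X]
    (W : X → X → ℝ → X)
    (hW : IsWMap W) (hUC : IsUCModulus W (fun _ ε => ε ^ 2 / 8))
    (C : Set X) (hne : C.Nonempty) (hconv : WConvex W C)
    (dC : ℝ) (hdC : 0 < dC) (hdiam : ∀ p ∈ C, ∀ q ∈ C, dist p q ≤ dC)
    (T : X → X) (k : ℕ → ℝ) (hT : AsymptoticallyNonexpansive C T k)
    (K : ℝ) (hK : 0 ≤ K) (hsum : ∀ n : ℕ, ∑ i ∈ Finset.range n, k i ≤ K)
    (L : ℕ) (hL : 2 ≤ L) (lam : ℕ → ℝ)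
    (hlam : ∀ n, 1 / (L : ℝ) ≤ lam n ∧ lam n ≤ 1 - 1 / (L : ℝ)) :
    ∀ x ∈ C, ∀ xseq : ℕ → X, IsKMIteration W T lam x xseq →
      Filter.Tendsto (fun n => dist (xseq n) (T (xseq n))) Filter.atTop (nhds 0) ∧
      ∀ ε : ℝ, 0 < ε → ε ≤ 1 →
        ∀ (fK D : ℝ) (M : ℕ),
          fK = 2 * (1 + (1 + K) ^ 2 * (2 + K)) →
          D = Real.exp K * (dC + 2) →
          M = ⌈1 / ε ^ 2 * (24 * (L : ℝ) ^ 2) * (5 * K * D + D + 11 / 2) * fK ^ 3 *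
                ((1 + K) * D + 1) ^ 2⌉₊ →
          ∃ N ≤ 2 * M, dist (xseq N) (T (xseq N)) < ε := by
  intro x hx u hu
  have hL0 : (0 : ℝ) < L := by
    have : 0 < L := by omega
    exact_mod_cast this
  have hl : 0 < 1 / (L : ℝ) := by positivity
  have hlam' : ∀ n, lam n ∈ Set.Icc (0 : ℝ) 1 := fun n =>
    ⟨by linarith [(hlam n).1], by linarith [(hlam n).2]⟩
  have hkK : ∀ n, k n ≤ K := fun n =>
    (Finset.single_le_sum (fun i _ => hT.2.1 i) (Finset.self_mem_range_succ n)).trans (hsum _)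
  have hmem := hu.mem hconv hT.1 hx hlam'
  have hstep := hu.dist_map_le hT hW hmem hkK hlam'
  set c : ℕ → ℝ := fun n => dist (u n) (T^[n] (u n)) with hc
  have hS : ∀ n, ∑ i ∈ Finset.range n, c i ^ 2 ≤ 4 * L * ((1 + K) * dC) ^ 2 := by
    intro n
    have h := hu.sum_sq_dist_le hT hW hUC hconv hx hdiam hsum hkK hl hlam n
    rw [one_div, inv_mul_le_iff₀ hL0] at h
    linarith
  constructor
  · have hc0 : Tendsto c atTop (nhds 0) := by
      have h := (summable_of_sum_range_le (fun n => sq_nonneg (c n)) hS).tendsto_atTop_zero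
      have h' := h.sqrt
      simpa [Real.sqrt_sq, hc] using h'
    rw [← tendsto_add_atTop_iff_nat 1]
    refine squeeze_zero (fun _ => dist_nonneg) hstep ?_
    have h := ((tendsto_add_atTop_iff_nat 1).2 hc0).add (hc0.const_mul ((1 + K) ^ 2))
    rwa [mul_zero, add_zero] at h
  · intro ε hε hε1 fK D M hfK hD hM
    by_contra! hcon
    have hpair : ∀ i < M, ε ^ 2 ≤ (1 + (1 + K) ^ 2) ^ 2 * (c (2 * i) ^ 2 + c (2 * i + 1) ^ 2) := by
      intro i hi
      have h1 := (hcon (2 * i + 1) (by omega)).trans (hstep (2 * i))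
      change ε ≤ c (2 * i + 1) + (1 + K) ^ 2 * c (2 * i) at h1
      have h2 : ε ^ 2 ≤ (c (2 * i + 1) + (1 + K) ^ 2 * c (2 * i)) ^ 2 := by gcongr
      have hq : 0 ≤ (1 + K) ^ 2 := by positivity
      set q := (1 + K) ^ 2
      have h3 : 0 ≤ q * (c (2 * i) ^ 2 + c (2 * i + 1) ^ 2) := by positivity
      nlinarith [sq_nonneg (c (2 * i) - q * c (2 * i + 1))]
    have hdouble : ∀ m, ∑ i ∈ Finset.range (2 * m), c i ^ 2 =
        ∑ i ∈ Finset.range m, (c (2 * i) ^ 2 + c (2 * i + 1) ^ 2) := by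
      intro m
      induction m with
      | zero => simp
      | succ m ih =>
        rw [Finset.sum_range_succ, ← ih, mul_add, mul_one, Finset.sum_range_succ,
          Finset.sum_range_succ]
        ring
    have hupper : M * ε ^ 2 ≤ (1 + (1 + K) ^ 2) ^ 2 * (4 * L * ((1 + K) * dC) ^ 2) := by
      have h := Finset.sum_le_sum fun i (hi : i ∈ Finset.range M) =>
        hpair i (Finset.mem_range.1 hi)
      rw [← Finset.mul_sum, ← hdouble] at h
      simp only [Finset.sum_const, Finset.card_range, nsmul_eq_mul] at h
      refine h.trans ?_
      gcongr
      exact hS _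
    have hDd : dC ≤ D := by
      rw [hD]
      have := Real.one_le_exp hK
      nlinarith
    have hD0 : 0 < D := hdC.trans_le hDd
    have hlower : 24 * (L : ℝ) ^ 2 * (5 * K * D + D + 11 / 2) * fK ^ 3 * ((1 + K) * D + 1) ^ 2 ≤
        M * ε ^ 2 := by
      have h := hM ▸ Nat.le_ceil (1 / ε ^ 2 * (24 * (L : ℝ) ^ 2) * (5 * K * D + D + 11 / 2) *
        fK ^ 3 * ((1 + K) * D + 1) ^ 2)
      refine le_trans (le_of_eq ?_) (mul_le_mul_of_nonneg_right h (sq_nonneg ε))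
      field_simp
    have hfK1 : 1 + (1 + K) ^ 2 ≤ fK := by
      rw [hfK]
      nlinarith [mul_nonneg (sq_nonneg (1 + K)) hK, sq_nonneg (1 + K)]
    have hfK3 : (1 + (1 + K) ^ 2) ^ 2 ≤ fK ^ 3 := by
      have h1 : 1 ≤ fK := by nlinarith [sq_nonneg (1 + K)]
      calc (1 + (1 + K) ^ 2) ^ 2 ≤ fK ^ 2 := by gcongr
        _ ≤ fK ^ 3 := pow_le_pow_right₀ h1 (by norm_num)
    have hLL : 4 * (L : ℝ) < 24 * (L : ℝ) ^ 2 * (5 * K * D + D + 11 / 2) := by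
      have h2 : (2 : ℝ) ≤ L := by exact_mod_cast hL
      have h3 : 1 ≤ 5 * K * D + D + 11 / 2 := by
        have : 0 ≤ 5 * K * D := by positivity
        linarith
      calc 4 * (L : ℝ) < 24 * (L : ℝ) ^ 2 * 1 := by nlinarith
        _ ≤ _ := by gcongr
    have hDD : ((1 + K) * dC) ^ 2 ≤ ((1 + K) * D + 1) ^ 2 := by
      gcongr
      nlinarith
    have hlt : 4 * L * (1 + (1 + K) ^ 2) ^ 2 * ((1 + K) * dC) ^ 2 <
        24 * (L : ℝ) ^ 2 * (5 * K * D + D + 11 / 2) * fK ^ 3 * ((1 + K) * D + 1) ^ 2 := by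
      calc 4 * L * (1 + (1 + K) ^ 2) ^ 2 * ((1 + K) * dC) ^ 2
          < 24 * (L : ℝ) ^ 2 * (5 * K * D + D + 11 / 2) * (1 + (1 + K) ^ 2) ^ 2 *
            ((1 + K) * dC) ^ 2 := by gcongr
        _ ≤ _ := by
          have : 0 ≤ 24 * (L : ℝ) ^ 2 * (5 * K * D + D + 11 / 2) := by positivity
          have : 0 ≤ fK := by nlinarith [sq_nonneg (1 + K)]
          gcongr
    linarith
end
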